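/- If G is a vertex-transitive graph with at least one vertex, then its fractional chromatic number satisfies χ_f(G) ≤ max{ω(G), (5/6)(Δ(G)+1)}. -/

import Mathlib

open SimpleGraph

/-- A graph is vertex-transitive if its automorphism group acts transitively
on the vertices. -/
def VertexTransitive {V : Type*} (G : SimpleGraph V) : Prop :=
  ∀ u v : V, ∃ e : G ≃g G, e u = v

/-- The fractional chromatic number of a finite graph `G`: the infimum of `a / b`
over all `b`-fold colorings of `G` with `a` colors (each vertex gets a set of `b`
colors out of `a`, adjacent vertices receiving disjoint sets). -/
noncomputable def fracChromaticNumber {V : Type*} [Fintype V] (G : SimpleGraph V) : ℝ :=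
  sInf {q : ℝ | ∃ a b : ℕ, 0 < b ∧ q = (a : ℝ) / (b : ℝ) ∧
    ∃ c : V → Finset (Fin a), (∀ v, (c v).card = b) ∧
      ∀ u v, G.Adj u v → Disjoint (c u) (c v)}

section IndependentTransversal

variable {V ι : Type*} [DecidableEq V] [DecidableEq ι]

/-- `g` chooses from `A`, for each label in `I`, a vertex with that label, so that the chosen
vertices are pairwise nonadjacent. -/
def IsIndepTransversal (G : SimpleGraph V) (A : Finset V) (p : V → ι) (I : Finset ι)
    (g : ι → V) : Prop :=
  (∀ k ∈ I, g k ∈ A ∧ p (g k) = k) ∧ ∀ k ∈ I, ∀ l ∈ I, k ≠ l → ¬ G.Adj (g k) (g l)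

/-- The graph `G` without the edges between `v` and `U`. -/
def deleteStar (G : SimpleGraph V) (v : V) (U : Finset V) : SimpleGraph V where
  Adj a b := G.Adj a b ∧ ¬ (a = v ∧ b ∈ U) ∧ ¬ (b = v ∧ a ∈ U)
  symm := ⟨fun _ _ h => ⟨h.1.symm, h.2.2, h.2.1⟩⟩
  loopless := ⟨fun a h => G.loopless.irrefl a h.1⟩

/-- If a set property fails on `∅` and holds on `U`, adding some single element turns it on. -/
lemma exists_insert_of_not_empty {α : Type*} [DecidableEq α] (P : Finset α → Prop) (h0 : ¬ P ∅)
    (U : Finset α) (hU : P U) : ∃ W t, ¬ P W ∧ P (insert t W) := by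
  induction U using Finset.induction_on with
  | empty => exact absurd hU h0
  | insert a s _ ih =>
    by_cases hs : P s
    · exact ih hs
    · exact ⟨s, a, hs, hU⟩

/-- If an independent transversal of all classes but that of `v` exists and none of all classes
does, then some family of classes, including that of `v`, is dominated by few vertices. -/
lemma exists_dominating_of_not_isIndepTransversal (n : ℕ) : ∀ (G : SimpleGraph V) (A : Finset V)
    (p : V → ι) (I : Finset ι) (v : V) (f : ι → V), I.card = n → v ∈ A → p v ∈ I →
    IsIndepTransversal G A p (I.erase (p v)) f → (∀ g, ¬ IsIndepTransversal G A p I g) →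
    ∃ S ⊆ I, p v ∈ S ∧ ∃ D : Finset V, D.card + 2 ≤ 2 * S.card ∧
      ∀ w ∈ A, p w ∈ S → ∃ d ∈ D, G.Adj d w := by
  classical
  induction n with
  | zero =>
    intro G A p I v f hI _ hv
    simp [Finset.card_eq_zero.1 hI] at hv
  | succ n ih =>
    intro G A p I v f hI hvA hvI hf hno
    obtain ⟨U, t, hU, g, hg⟩ := exists_insert_of_not_empty
      (fun U => ∃ g, IsIndepTransversal (deleteStar G v U) A p I g) (by
        rintro ⟨g, hg⟩
        refine hno g ⟨hg.1, fun k hk l hl hkl h => hg.2 k hk l hl hkl ?_⟩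
        simpa [deleteStar] using h) (I.image f) (by
        refine ⟨Function.update f (p v) v, fun k hk => ?_, fun k hk l hl hkl h => ?_⟩
        · by_cases h : k = p v
          · subst h; simpa using hvA
          · simpa [h] using hf.1 k (by simp [h, hk])
        · by_cases h1 : k = p v
          · have h2 : l ≠ p v := by grind
            subst h1
            simp only [deleteStar, Function.update_self, Function.update_of_ne h2] at h
            exact h.2.1 ⟨trivial, Finset.mem_image_of_mem f hl⟩
          · by_cases h2 : l = p v
            · subst h2
              simp only [deleteStar, Function.update_self, Function.update_of_ne h1] at h
              exact h.2.2 ⟨trivial, Finset.mem_image_of_mem f hk⟩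
            · simp only [Function.update_of_ne h1, Function.update_of_ne h2] at h
              exact hf.2 k (by simp [h1, hk]) l (by simp [h2, hl]) hkl h.1)
    set H := deleteStar G v U with hH
    have hHG : ∀ a b, H.Adj a b → G.Adj a b := fun a b h => h.1
    have hconf : ∀ k ∈ I, ∀ l ∈ I, k ≠ l → H.Adj (g k) (g l) →
        (g k = v ∧ g l = t) ∨ (g l = v ∧ g k = t) := by
      intro k hk l hl hkl h
      have h1 := hg.2 k hk l hl hkl
      simp only [hH, deleteStar, Finset.mem_insert] at h h1
      tauto
    have hgv : ∀ k ∈ I, g k = v → k = p v := fun k hk h => by rw [← h, (hg.1 k hk).2]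
    obtain ⟨hgi, l, hlI, hli, hlt⟩ : g (p v) = v ∧ ∃ l ∈ I, l ≠ p v ∧ g l = t := by
      by_contra hcon
      refine hU ⟨g, hg.1, fun k hk l hl hkl h => hcon ?_⟩
      rcases hconf k hk l hl hkl h with ⟨h1, h2⟩ | ⟨h1, h2⟩
      · have := hgv k hk h1
        exact ⟨by rw [← this]; exact h1, l, hl, by grind, h2⟩
      · have := hgv l hl h1
        exact ⟨by rw [← this]; exact h1, k, hk, by grind, h2⟩
    have hpt : p t = l := by rw [← hlt, (hg.1 l hlI).2]
    have htA : t ∈ A := by rw [← hlt]; exact (hg.1 l hlI).1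
    set A' := A.filter (fun w => ¬ H.Adj v w ∧ ¬ H.Adj t w) with hA'
    set q : V → ι := fun w => if p w = l then p v else p w with hq
    by_cases hleft : ∃ v' ∈ A', q v' = p v
    · obtain ⟨v', hv'A, hv'q⟩ := hleft
      obtain ⟨S, hSI, hvS, D, hD, hdom⟩ := ih H A' q (I.erase l) v' g
        (by rw [Finset.card_erase_of_mem hlI, hI]; rfl) hv'A
        (by rw [hv'q]; simp [hvI, hli.symm]) (by
          rw [hv'q]
          refine ⟨fun k hk => ?_, fun k hk m hm hkm h => ?_⟩
          · simp only [Finset.mem_erase] at hk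
            have hk1 := hg.1 k hk.2.2
            refine ⟨?_, by simp [hq, hk1.2, hk.2.1]⟩
            simp only [hA', Finset.mem_filter]
            refine ⟨hk1.1, fun h => ?_, fun h => ?_⟩
            · have h3 := hconf (p v) hvI k hk.2.2 (Ne.symm hk.1) (by rwa [hgi])
              have h4 := hgv k hk.2.2
              have : g k = t → k = l := fun h => by rw [← hpt, ← h, hk1.2]
              grind
            · have h3 := hconf l hlI k hk.2.2 (Ne.symm hk.2.1) (by rwa [hlt])
              have h4 := hgv k hk.2.2
              have h5 := hgv l hlI
              have : g k = t → k = l := fun h => by rw [← hpt, ← h, hk1.2]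
              grind
          · simp only [Finset.mem_erase] at hk hm
            have h3 := hconf k hk.2.2 m hm.2.2 hkm h
            have h4 := hgv k hk.2.2
            have h5 := hgv m hm.2.2
            grind) (by
          intro T hT
          have hTi := hT.1 (p v) (by simp [hvI, hli.symm])
          have hTA : ∀ k ∈ I, k ≠ l → T k ∈ A ∧ ¬ H.Adj v (T k) ∧ ¬ H.Adj t (T k) := by
            intro k hk hkl
            simpa [hA'] using (hT.1 k (by simp [hk, hkl])).1
          have hTp : ∀ k ∈ I, k ≠ l → k ≠ p v → p (T k) = k := by
            intro k hk hkl hkv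
            have h1 := (hT.1 k (by simp [hk, hkl])).2
            simp only [hq] at h1
            split_ifs at h1 with h2
            · exact absurd h1.symm hkv
            · exact h1
          have hTT : ∀ k ∈ I, k ≠ l → ∀ m ∈ I, m ≠ l → k ≠ m → ¬ H.Adj (T k) (T m) :=
            fun k hk hkl m hm hml hkm => hT.2 k (by simp [hk, hkl]) m (by simp [hm, hml]) hkm
          by_cases hz : p (T (p v)) = l
          · refine hU ⟨fun k => if k = l then T (p v) else if k = p v then v else T k,
              fun k hk => ?_, fun k hk m hm hkm => ?_⟩
            · have := hTA (p v) hvI hli.symm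
              grind
            · have hs := H.adj_comm
              have := hTA (p v) hvI hli.symm
              grind
          · have hz' : p (T (p v)) = p v := by simpa [hq, hz] using hTi.2
            refine hU ⟨fun k => if k = l then t else T k,
              fun k hk => ?_, fun k hk m hm hkm => ?_⟩
            · grind
            · have hs := H.adj_comm
              grind)
      rw [hv'q] at hvS
      have hlS : l ∉ S := fun h => by simpa using hSI h
      refine ⟨insert l S, ?_, by simp [hvS], D ∪ {v, t}, ?_, ?_⟩
      · intro k hk
        rcases Finset.mem_insert.1 hk with rfl | hk
        · exact hlI
        · exact Finset.mem_of_mem_erase (hSI hk)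
      · rw [Finset.card_insert_of_notMem hlS]
        have h1 := Finset.card_union_le D {v, t}
        have h2 : ({v, t} : Finset V).card ≤ 2 := Finset.card_le_two
        omega
      · intro w hw hwS
        by_cases hwA : w ∈ A'
        · obtain ⟨d, hd, hdw⟩ := hdom w hwA (by
            simp only [hq]
            split_ifs with h
            · exact hvS
            · simpa [h] using hwS)
          exact ⟨d, by simp [hd], hHG _ _ hdw⟩
        · by_cases h1 : H.Adj v w
          · exact ⟨v, by simp, hHG _ _ h1⟩
          · refine ⟨t, by simp, hHG _ _ ?_⟩
            simp only [hA', Finset.mem_filter] at hwA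
            tauto
    · refine ⟨{p v, l}, by simp [Finset.insert_subset_iff, hvI, hlI], by simp, {v, t}, ?_, ?_⟩
      · rw [Finset.card_pair hli.symm]
        have h2 : ({v, t} : Finset V).card ≤ 2 := Finset.card_le_two
        omega
      · intro w hw hwS
        have hwA : w ∉ A' := fun h => hleft ⟨w, h, by
          simp only [Finset.mem_insert, Finset.mem_singleton] at hwS
          simp only [hq]
          split_ifs with h
          · rfl
          · tauto⟩
        by_cases h1 : H.Adj v w
        · exact ⟨v, by simp, hHG _ _ h1⟩
        · refine ⟨t, by simp, hHG _ _ ?_⟩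
          simp only [hA', Finset.mem_filter] at hwA
          tauto

/-- Haxell's theorem: classes of size at least twice the maximum degree admit an
independent transversal. -/
theorem exists_isIndepTransversal [Fintype V] (G : SimpleGraph V) [DecidableRel G.Adj]
    (p : V → ι) (m d : ℕ) (hm : 0 < m) (hmd : 2 * d ≤ m) (hdeg : ∀ v, G.degree v ≤ d)
    (I : Finset ι) (hI : ∀ i ∈ I, m ≤ (Finset.univ.filter (fun v => p v = i)).card)
    (f₀ : ι → V) : ∃ g, IsIndepTransversal G Finset.univ p I g := by
  induction I using Finset.induction_on with
  | empty => exact ⟨f₀, by simp [IsIndepTransversal]⟩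
  | insert i I hi ih =>
    obtain ⟨f, hf⟩ := ih fun k hk => hI k (Finset.mem_insert_of_mem hk)
    by_contra hno
    push Not at hno
    obtain ⟨v, hv⟩ := Finset.card_pos.1 (hm.trans_le (hI i (Finset.mem_insert_self _ _)))
    have hvi : p v = i := by simpa using hv
    subst hvi
    obtain ⟨S, hS, hvS, D, hD, hdom⟩ := exists_dominating_of_not_isIndepTransversal _ G
      Finset.univ p (insert (p v) I) v f rfl (by simp) (by simp)
      (by rwa [Finset.erase_insert hi]) hno
    have h1 : (Finset.univ.filter (fun w => p w ∈ S)).card ≤ D.card * d := by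
      calc _ ≤ (D.biUnion fun x => G.neighborFinset x).card := by
            refine Finset.card_le_card fun w hw => ?_
            obtain ⟨x, hx, hxw⟩ := hdom w (by simp) (by simpa using hw)
            exact Finset.mem_biUnion.2 ⟨x, hx, by simpa using hxw⟩
        _ ≤ D.card * d := Finset.card_biUnion_le_card_mul _ _ _ fun x _ => by
            simpa using hdeg x
    have h2 : S.card * m ≤ (Finset.univ.filter (fun w => p w ∈ S)).card := by
      rw [Finset.card_eq_sum_card_fiberwise (f := p) (t := S) (fun w hw => by simpa using hw),
        ← smul_eq_mul]
      refine Finset.card_nsmul_le_sum _ _ _ fun i hi => (hI i (hS hi)).trans_eq ?_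
      congr 1
      ext w
      simp only [Finset.mem_filter, Finset.mem_univ, true_and]
      exact ⟨fun h => ⟨h ▸ hi, h⟩, fun h => h.2⟩
    have h3 : 0 < S.card := Finset.card_pos.2 ⟨_, hvS⟩
    have h4 : D.card * d + 2 * d ≤ S.card * m := by
      calc D.card * d + 2 * d = (D.card + 2) * d := by ring
        _ ≤ (2 * S.card) * d := Nat.mul_le_mul_right _ hD
        _ = S.card * (2 * d) := by ring
        _ ≤ S.card * m := Nat.mul_le_mul_left _ hmd
    have h5 : 0 < S.card * m := Nat.mul_pos h3 hm
    have h6 : d = 0 := by omega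
    subst h6
    omega

end IndependentTransversal

section Bounds

variable {V : Type*} [Fintype V] [DecidableEq V] (G : SimpleGraph V) [DecidableRel G.Adj]

/-- Hajnal's inequality for a family of maximum cliques. -/
lemma two_mul_cliqueNum_le_card_inter_add_card_union (F : Finset (Finset V)) (hF : F.Nonempty)
    (hcl : ∀ K ∈ F, G.IsNClique G.cliqueNum K) :
    2 * G.cliqueNum ≤ (Finset.univ.filter fun v => ∀ K ∈ F, v ∈ K).card
      + (Finset.univ.filter fun v => ∃ K ∈ F, v ∈ K).card := by
  induction hF using Finset.Nonempty.cons_induction with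
  | singleton K =>
    have := (hcl K (by simp)).card_eq
    simp [this, two_mul]
  | cons K F hK hF ih =>
    have ih := ih fun L hL => hcl L (by simp [hL])
    have hKc := hcl K (by simp)
    set A := Finset.univ.filter fun v => ∀ K ∈ F, v ∈ K with hA
    set B := Finset.univ.filter fun v => ∃ K ∈ F, v ∈ K with hB
    have e1 : (Finset.univ.filter fun v => ∀ L ∈ Finset.cons K F hK, v ∈ L) = A ∩ K := by
      ext v; simp [hA, and_comm]
    have e2 : (Finset.univ.filter fun v => ∃ L ∈ Finset.cons K F hK, v ∈ L) = B ∪ K := by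
      ext v; simp [hB, or_comm]
    rw [e1, e2]
    have hAB : ∀ a ∈ A, ∀ b ∈ B, a ≠ b → G.Adj a b := by
      intro a ha b hb hab
      simp only [hA, hB, Finset.mem_filter, Finset.mem_univ, true_and] at ha hb
      obtain ⟨L, hL, hbL⟩ := hb
      exact (hcl L (by simp [hL])).isClique (ha L hL) hbL hab
    have hsub : A ⊆ B := by
      intro a ha
      obtain ⟨L, hL⟩ := hF
      simp only [hA, hB, Finset.mem_filter, Finset.mem_univ, true_and] at ha ⊢
      exact ⟨L, hL, ha L hL⟩
    have hclq : G.IsClique (A ∪ (K ∩ B) : Finset V) := by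
      intro a ha b hb hab
      simp only [Finset.coe_union, Finset.coe_inter, Set.mem_union, Set.mem_inter_iff,
        Finset.mem_coe] at ha hb
      rcases ha with ha | ha <;> rcases hb with hb | hb
      · exact hAB a ha b (hsub hb) hab
      · exact hAB a ha b hb.2 hab
      · exact (hAB b hb a ha.2 hab.symm).symm
      · exact hKc.isClique ha.1 hb.1 hab
    have h1 := hclq.card_le_cliqueNum
    have h2 := Finset.card_union_add_card_inter A (K ∩ B)
    have h3 : A ∩ (K ∩ B) = A ∩ K := by
      ext a; have := @hsub a; simp only [Finset.mem_inter]; tauto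
    have h4 := Finset.card_union_add_card_inter B K
    rw [h3] at h2
    rw [Finset.inter_comm B K, hKc.card_eq] at h4
    omega

/-- Averaged over all maximum independent sets `S`, the number of neighbours of `v` in `S` plus
`ω + 1` times the indicator of `v ∈ S` is at least `2`. -/
lemma two_mul_card_le_sum_maximum_indepSets (v : V) (M : Finset (Finset V))
    (hM : ∀ S, S ∈ M ↔ G.IsNIndepSet G.indepNum S) :
    2 * M.card ≤ ∑ S ∈ M, ((S ∩ G.neighborFinset v).card
      + if v ∈ S then G.cliqueNum + 1 else 0) := by
  classical
  obtain ⟨k, hk⟩ : ∃ k, G.cliqueNum = k + 1 := by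
    have h : G.IsClique ({v} : Finset V) := by simp
    have := h.card_le_cliqueNum
    exact ⟨G.cliqueNum - 1, by simp at this; omega⟩
  have hind : ∀ S ∈ M, ∀ a ∈ S, ∀ b ∈ S, ¬ G.Adj a b := by
    intro S hS a ha b hb h
    exact ((hM S).1 hS).isIndepSet ha hb h.ne h
  have hcard : ∀ S ∈ M, S.card = G.indepNum := fun S hS => ((hM S).1 hS).card_eq
  have hmk : ∀ S : Finset V, (∀ a ∈ S, ∀ b ∈ S, ¬ G.Adj a b) → S.card ≤ G.indepNum := by
    intro S hS
    exact IsIndepSet.card_le_indepNum (G := G) (t := S) fun a ha b hb _ => hS a ha b hb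
  set Mv := M.filter fun S => v ∈ S with hMv
  set M1 := M.filter fun S => v ∉ S ∧ (S ∩ G.neighborFinset v).card = 1 with hM1
  have key : M1.card ≤ k * Mv.card := by
    have hw : ∀ S ∈ M1, ∃ w, S ∩ G.neighborFinset v = {w} := fun S hS =>
      Finset.card_eq_one.1 (Finset.mem_filter.1 hS).2.2
    have : Nonempty V := ⟨v⟩
    choose! w hw using hw
    have hwS : ∀ S ∈ M1, w S ∈ S ∧ G.Adj v (w S) ∧ ∀ a ∈ S, G.Adj v a → a = w S := by
      intro S hS
      have h := hw S hS
      have h1 : w S ∈ S ∩ G.neighborFinset v := by rw [h]; simp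
      refine ⟨(Finset.mem_inter.1 h1).1, by simpa using (Finset.mem_inter.1 h1).2, ?_⟩
      intro a ha hva
      have : a ∈ S ∩ G.neighborFinset v := by simp [ha, hva]
      simpa [h] using this
    refine Finset.card_le_mul_card_image_of_maps_to (f := fun S => insert v (S.erase (w S)))
      ?_ k ?_
    · intro S hS
      obtain ⟨h1, h2, h3⟩ := hwS S hS
      have hS' := Finset.mem_filter.1 hS
      have hvS : v ∉ S.erase (w S) := fun h => hS'.2.1 (Finset.mem_of_mem_erase h)
      refine Finset.mem_filter.2 ⟨(hM _).2 ⟨?_, ?_⟩, by simp⟩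
      · have := hind S hS'.1
        have hs := G.adj_comm
        have := G.loopless.irrefl v
        intro a ha b hb hab h
        simp only [Finset.coe_insert, Finset.coe_erase, Set.mem_insert_iff, Set.mem_sdiff,
          Finset.mem_coe, Set.mem_singleton_iff] at ha hb
        grind
      · rw [Finset.card_insert_of_notMem hvS, Finset.card_erase_of_mem h1, hcard S hS'.1]
        have := Finset.card_pos.2 ⟨_, h1⟩
        have := hcard S hS'.1
        omega
    · intro T _
      set Fb := M1.filter fun S => insert v (S.erase (w S)) = T with hFb
      have her : ∀ S ∈ Fb, S.erase (w S) = T.erase v := by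
        intro S hS
        have h := Finset.mem_filter.1 hS
        have hvS : v ∉ S.erase (w S) := fun h' =>
          (Finset.mem_filter.1 h.1).2.1 (Finset.mem_of_mem_erase h')
        rw [← h.2, Finset.erase_insert hvS]
      have hFM : ∀ S ∈ Fb, S ∈ M1 := fun S hS => (Finset.mem_filter.1 hS).1
      have hSins : ∀ S ∈ Fb, S = insert (w S) (T.erase v) := by
        intro S hS
        rw [← her S hS, Finset.insert_erase (hwS S (hFM S hS)).1]
      have hinj : Set.InjOn w Fb := by
        intro S hS S' hS' h
        rw [hSins S hS, hSins S' hS', h]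
      have hclq : G.IsClique (insert v (Fb.image w) : Finset V) := by
        rw [Finset.coe_insert, SimpleGraph.isClique_insert]
        constructor
        · intro a ha b hb hab
          obtain ⟨S, hS, rfl⟩ := Finset.mem_image.1 (Finset.mem_coe.1 ha)
          obtain ⟨S', hS', rfl⟩ := Finset.mem_image.1 (Finset.mem_coe.1 hb)
          by_contra hadj
          have hSM := (Finset.mem_filter.1 (hFM S hS)).1
          have hSM' := (Finset.mem_filter.1 (hFM S' hS')).1
          have i1 := hind S hSM
          have i2 := hind S' hSM'
          have j1 := hSins S hS
          have j2 := hSins S' hS'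
          have hs := G.adj_comm
          have hirr := G.loopless.irrefl (w S')
          have hn : w S' ∉ S := by
            intro h
            exact hab ((hwS S (hFM S hS)).2.2 _ h (hwS S' (hFM S' hS')).2.1).symm
          have := hmk (insert (w S') S) (by
            intro a ha b hb
            have m1 : ∀ a ∈ S, a = w S ∨ a ∈ S' := by
              intro a ha; rw [j1] at ha; rw [j2]; simp only [Finset.mem_insert] at ha ⊢; tauto
            have m2 := (hwS S' (hFM S' hS')).1
            grind)
          rw [Finset.card_insert_of_notMem hn, hcard S hSM] at this
          omega
        · intro b hb _
          obtain ⟨S, hS, rfl⟩ := Finset.mem_image.1 (Finset.mem_coe.1 hb)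
          exact (hwS S (hFM S hS)).2.1
      have hv : v ∉ Fb.image w := by
        intro h
        obtain ⟨S, hS, hSv⟩ := Finset.mem_image.1 h
        exact (hwS S (hFM S hS)).2.1.ne hSv.symm
      have := hclq.card_le_cliqueNum
      rw [Finset.card_insert_of_notMem hv, Finset.card_image_of_injOn hinj, hk] at this
      omega
  have hpt : ∀ S ∈ M, 2 + (if v ∈ S then k else 0) ≤
      ((S ∩ G.neighborFinset v).card + if v ∈ S then G.cliqueNum + 1 else 0) +
        (if v ∉ S ∧ (S ∩ G.neighborFinset v).card = 1 then 1 else 0) := by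
    intro S hS
    by_cases hvS : v ∈ S
    · simp [hvS, hk]; omega
    · have : (S ∩ G.neighborFinset v).card ≠ 0 := by
        intro h
        rw [Finset.card_eq_zero] at h
        have hn : ∀ a ∈ S, ¬ G.Adj v a := by
          intro a ha hva
          have : a ∈ S ∩ G.neighborFinset v := by simp [ha, hva]
          simp [h] at this
        have hs := G.adj_comm
        have hirr := G.loopless.irrefl v
        have i1 := hind S hS
        have := hmk (insert v S) (by grind)
        rw [Finset.card_insert_of_notMem hvS, hcard S hS] at this
        omega
      simp only [hvS, if_false, not_false_eq_true, true_and]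
      split_ifs <;> omega
  have hsum := Finset.sum_le_sum hpt
  rw [Finset.sum_add_distrib, Finset.sum_add_distrib (g := fun S =>
    if v ∉ S ∧ (S ∩ G.neighborFinset v).card = 1 then 1 else 0), ← Finset.sum_filter,
    ← Finset.sum_filter (p := fun S => v ∉ S ∧ (S ∩ G.neighborFinset v).card = 1)] at hsum
  simp only [Finset.sum_const, smul_eq_mul, mul_one] at hsum
  rw [← hMv, ← hM1, mul_comm Mv.card] at hsum
  omega

/-- The independence-ratio form of the fractional version of Reed's conjecture. -/
theorem two_mul_card_le_indepNum_mul :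
    2 * Fintype.card V ≤ G.indepNum * (G.cliqueNum + G.maxDegree + 1) := by
  classical
  set M : Finset (Finset V) := Finset.univ.filter fun S => G.IsNIndepSet G.indepNum S with hM
  have hM' : ∀ S, S ∈ M ↔ G.IsNIndepSet G.indepNum S := by simp [hM]
  obtain ⟨S₀, hS₀⟩ := G.exists_isNIndepSet_indepNum
  have hpos : 0 < M.card := Finset.card_pos.2 ⟨S₀, (hM' _).2 hS₀⟩
  have h := Finset.sum_le_sum fun v (_ : v ∈ Finset.univ) =>
    two_mul_card_le_sum_maximum_indepSets G v M hM'
  rw [Finset.sum_comm] at h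
  have hS : ∀ S ∈ M, ∑ v, ((S ∩ G.neighborFinset v).card
      + if v ∈ S then G.cliqueNum + 1 else 0) ≤
      G.indepNum * (G.cliqueNum + G.maxDegree + 1) := by
    intro S hS
    have hc : S.card = G.indepNum := ((hM' S).1 hS).card_eq
    have e : ∑ v, (S ∩ G.neighborFinset v).card = ∑ s ∈ S, G.degree s := by
      have h1 : ∀ v, (S ∩ G.neighborFinset v).card = ∑ s ∈ S, if G.Adj v s then 1 else 0 := by
        intro v
        rw [← Finset.card_filter]
        congr 1
        ext a; simp
      simp_rw [h1]
      rw [Finset.sum_comm]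
      refine Finset.sum_congr rfl fun s _ => ?_
      rw [← Finset.card_filter, ← G.card_neighborFinset_eq_degree]
      congr 1
      ext a; simp [G.adj_comm]
    have e2 : ∑ s ∈ S, G.degree s ≤ S.card * G.maxDegree := by
      rw [← smul_eq_mul]
      exact Finset.sum_le_card_nsmul _ _ _ fun s _ => G.degree_le_maxDegree s
    rw [Finset.sum_add_distrib, e]
    simp only [Finset.sum_ite_mem, Finset.univ_inter, Finset.sum_const, smul_eq_mul]
    rw [hc] at e2 ⊢
    nlinarith
  have h2 := h.trans (Finset.sum_le_card_nsmul _ _ _ hS)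
  simp only [Finset.sum_const, Finset.card_univ, smul_eq_mul] at h2
  refine Nat.le_of_mul_le_mul_left ?_ hpos
  linarith [h2]

/-- The maximum cliques of a vertex-transitive graph with large clique number are disjoint. -/
lemma maximum_cliques_eq_of_mem (hvt : VertexTransitive G)
    (hω : 2 * (G.maxDegree + 1) < 3 * G.cliqueNum) {K L : Finset V}
    (hK : G.IsNClique G.cliqueNum K) (hL : G.IsNClique G.cliqueNum L) {v : V}
    (hvK : v ∈ K) (hvL : v ∈ L) : K = L := by
  classical
  set cl : V → Finset (Finset V) := fun u =>
    Finset.univ.filter fun K => G.IsNClique G.cliqueNum K ∧ u ∈ K with hcl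
  have hmem : ∀ u K, K ∈ cl u ↔ G.IsNClique G.cliqueNum K ∧ u ∈ K := by simp [hcl]
  have hle : ∀ u u', (cl u).card ≤ (cl u').card := by
    intro u u'
    obtain ⟨e, he⟩ := hvt u u'
    refine Finset.card_le_card_of_injOn (fun K => K.map e.toEquiv.toEmbedding) ?_
      (Finset.map_injective _).injOn
    intro K hK
    obtain ⟨h1, h2⟩ := (hmem _ _).1 hK
    refine (hmem _ _).2 ⟨⟨?_, by simpa using h1.card_eq⟩, ?_⟩
    · intro a ha b hb hab
      simp only [Finset.coe_map, Set.mem_image, Finset.mem_coe] at ha hb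
      obtain ⟨a, ha, rfl⟩ := ha
      obtain ⟨b, hb, rfl⟩ := hb
      exact e.map_adj_iff.2 (h1.isClique ha hb fun h => hab (by rw [h]))
    · exact Finset.mem_map.2 ⟨u, h2, he⟩
  set C : V → Finset V := fun u => Finset.univ.filter fun x => cl x = cl u with hC
  have hbig : ∀ u, (cl u).Nonempty → 2 * G.cliqueNum ≤ (C u).card + (G.maxDegree + 1) := by
    intro u hu
    refine (two_mul_cliqueNum_le_card_inter_add_card_union G (cl u) hu
      fun K hK => ((hmem _ _).1 hK).1).trans (Nat.add_le_add (Finset.card_le_card ?_) ?_)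
    · intro x hx
      simp only [Finset.mem_filter, Finset.mem_univ, true_and, hC] at hx ⊢
      refine (Finset.eq_of_subset_of_card_le (fun K hK => ?_) (hle _ _)).symm
      exact (hmem _ _).2 ⟨((hmem _ _).1 hK).1, hx K hK⟩
    · calc _ ≤ (insert u (G.neighborFinset u)).card := by
            refine Finset.card_le_card fun x hx => ?_
            simp only [Finset.mem_filter, Finset.mem_univ, true_and] at hx
            obtain ⟨K, hK, hxK⟩ := hx
            obtain ⟨h1, h2⟩ := (hmem _ _).1 hK
            by_cases hxu : x = u
            · simp [hxu]
            · simpa [hxu] using h1.isClique h2 hxK (Ne.symm hxu)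
        _ ≤ G.maxDegree + 1 := by
            refine (Finset.card_insert_le _ _).trans ?_
            simpa using G.degree_le_maxDegree u
  by_contra hne
  have hex : ∀ {K L : Finset V}, G.IsNClique G.cliqueNum K → G.IsNClique G.cliqueNum L → K ≠ L →
      ∃ x ∈ K, x ∉ L := by
    intro K L hK hL hne
    by_contra! h
    exact hne (Finset.eq_of_subset_of_card_le h (by rw [hK.card_eq, hL.card_eq]))
  obtain ⟨x, hxK, hxL⟩ := hex hK hL hne
  obtain ⟨y, hyL, hyK⟩ := hex hL hK (Ne.symm hne)
  have hKv := (hmem v K).2 ⟨hK, hvK⟩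
  have hLv := (hmem v L).2 ⟨hL, hvL⟩
  have hKx := (hmem x K).2 ⟨hK, hxK⟩
  have hLx : L ∉ cl x := fun h => hxL ((hmem _ _).1 h).2
  have hLy := (hmem y L).2 ⟨hL, hyL⟩
  have hKy : K ∉ cl y := fun h => hyK ((hmem _ _).1 h).2
  have bv := hbig v ⟨K, hKv⟩
  have bx := hbig x ⟨K, hKx⟩
  have bY := hbig y ⟨L, hLy⟩
  have hdis : ∀ a b, cl a ≠ cl b → Disjoint (C a) (C b) := by
    intro a b hab
    rw [Finset.disjoint_left]
    intro z hz hz'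
    simp only [hC, Finset.mem_filter, Finset.mem_univ, true_and] at hz hz'
    exact hab (hz.symm.trans hz')
  have d1 : Disjoint (C v) (C x) := hdis _ _ fun h => hLx (h ▸ hLv)
  have d2 : Disjoint (C v) (C y) := hdis _ _ fun h => hKy (h ▸ hKv)
  have d3 : Disjoint (C x) (C y) := hdis _ _ fun h => hKy (h ▸ hKx)
  have hsub : (C v ∪ C x) ∪ C y ⊆ insert v (G.neighborFinset v) := by
    have hnb : ∀ z, (K ∈ cl z ∨ L ∈ cl z) → z ∈ insert v (G.neighborFinset v) := by
      intro z hz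
      by_cases hzv : z = v
      · simp [hzv]
      · rcases hz with hz | hz
        · simpa [hzv] using hK.isClique hvK ((hmem _ _).1 hz).2 (Ne.symm hzv)
        · simpa [hzv] using hL.isClique hvL ((hmem _ _).1 hz).2 (Ne.symm hzv)
    intro z hz
    simp only [hC, Finset.mem_union, Finset.mem_filter, Finset.mem_univ, true_and] at hz
    apply hnb
    rcases hz with (hz | hz) | hz <;> rw [hz] <;> tauto
  have hc := Finset.card_le_card hsub
  rw [Finset.card_union_of_disjoint (Finset.disjoint_union_left.2 ⟨d2, d3⟩),
    Finset.card_union_of_disjoint d1] at hc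
  have hc2 := Finset.card_insert_le v (G.neighborFinset v)
  have hc3 := G.degree_le_maxDegree v
  rw [G.card_neighborFinset_eq_degree] at hc2
  omega

/-- A vertex-transitive graph with large clique number has an independent set meeting every
maximum clique. -/
theorem card_le_indepNum_mul_cliqueNum [Nonempty V] (hvt : VertexTransitive G)
    (hω : 2 * (G.maxDegree + 1) < 3 * G.cliqueNum) :
    Fintype.card V ≤ G.indepNum * G.cliqueNum := by
  classical
  have hex : ∀ v, ∃ K : Finset V, G.IsNClique G.cliqueNum K ∧ v ∈ K := by
    obtain ⟨K, hK⟩ := G.exists_isNClique_cliqueNum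
    obtain ⟨u, hu⟩ : K.Nonempty := Finset.card_pos.1 (by rw [hK.card_eq]; omega)
    intro v
    obtain ⟨e, he⟩ := hvt u v
    refine ⟨K.map e.toEquiv.toEmbedding, ⟨?_, by simpa using hK.card_eq⟩,
      Finset.mem_map.2 ⟨u, hu, he⟩⟩
    intro a ha b hb hab
    simp only [Finset.coe_map, Set.mem_image, Finset.mem_coe] at ha hb
    obtain ⟨a, ha, rfl⟩ := ha
    obtain ⟨b, hb, rfl⟩ := hb
    exact e.map_adj_iff.2 (hK.isClique ha hb fun h => hab (by rw [h]))
  choose p hp hvp using hex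
  have hfib : ∀ u v, p u = p v ↔ u ∈ p v := fun u v =>
    ⟨fun h => h ▸ hvp u, fun h => maximum_cliques_eq_of_mem G hvt hω (hp u) (hp v) (hvp u) h⟩
  have hfc : ∀ i ∈ Finset.univ.image p,
      (Finset.univ.filter fun v => p v = i).card = G.cliqueNum := by
    intro i hi
    obtain ⟨v, -, rfl⟩ := Finset.mem_image.1 hi
    rw [← (hp v).card_eq]
    congr 1
    ext u; simp [hfib]
  let H : SimpleGraph V :=
    { Adj := fun a b => G.Adj a b ∧ p a ≠ p b
      symm := ⟨fun _ _ h => ⟨h.1.symm, h.2.symm⟩⟩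
      loopless := ⟨fun _ h => h.2 rfl⟩ }
  obtain ⟨g, hg⟩ := exists_isIndepTransversal H p G.cliqueNum (G.maxDegree + 1 - G.cliqueNum)
    (by omega) (by omega) (by
      intro v
      have h1 : H.neighborFinset v ∪ p v ⊆ insert v (G.neighborFinset v) := by
        intro u hu
        by_cases huv : u = v
        · simp [huv]
        · rcases Finset.mem_union.1 hu with hu | hu
          · have : H.Adj v u := by simpa using hu
            simpa [huv] using this.1
          · simpa [huv] using (hp v).isClique (hvp v) hu (Ne.symm huv)
      have h2 : Disjoint (H.neighborFinset v) (p v) := by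
        rw [Finset.disjoint_left]
        intro u hu huv
        have : H.Adj v u := by simpa using hu
        exact this.2 ((hfib u v).2 huv).symm
      have h3 := Finset.card_le_card h1
      have h4 := Finset.card_insert_le v (G.neighborFinset v)
      have h5 := G.degree_le_maxDegree v
      rw [Finset.card_union_of_disjoint h2, (hp v).card_eq, H.card_neighborFinset_eq_degree] at h3
      rw [G.card_neighborFinset_eq_degree] at h4
      omega) (Finset.univ.image p) (fun i hi => (hfc i hi).ge) (fun _ => Classical.arbitrary V)
  have hinj : Set.InjOn g (Finset.univ.image p) := by
    intro i hi j hj h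
    rw [← (hg.1 i hi).2, ← (hg.1 j hj).2, h]
  have hind : G.IsIndepSet ((Finset.univ.image p).image g : Finset V) := by
    intro a ha b hb hab h
    obtain ⟨i, hi, rfl⟩ := Finset.mem_image.1 (Finset.mem_coe.1 ha)
    obtain ⟨j, hj, rfl⟩ := Finset.mem_image.1 (Finset.mem_coe.1 hb)
    have hij : i ≠ j := fun h => hab (by rw [h])
    refine hg.2 i hi j hj hij ⟨h, ?_⟩
    rw [(hg.1 i hi).2, (hg.1 j hj).2]
    exact hij
  have h1 := hind.card_le_indepNum
  rw [Finset.card_image_of_injOn hinj] at h1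
  have h2 := Finset.card_eq_sum_card_image p (Finset.univ : Finset V)
  rw [Finset.sum_congr rfl hfc, Finset.sum_const, smul_eq_mul, Finset.card_univ] at h2
  rw [h2]
  exact Nat.mul_le_mul_right _ h1

end Bounds

/-- The translates of an independent set of a vertex-transitive graph give a fractional
coloring. -/
theorem fracChromaticNumber_le_card_div_card {V : Type*} [Fintype V] [Nonempty V]
    (G : SimpleGraph V) (hvt : VertexTransitive G) (S : Finset V) (hS : G.IsIndepSet S) (hne : S.Nonempty) :
    fracChromaticNumber G ≤ (Fintype.card V : ℝ) / S.card := by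
  classical
  have : Finite (G ≃g G) := Finite.of_injective _ (DFunLike.coe_injective (F := G ≃g G))
  have : Fintype (G ≃g G) := Fintype.ofFinite _
  set cov : V → Finset (G ≃g G) := fun v => Finset.univ.filter fun e => e v ∈ S with hcov
  have hle : ∀ u v, (cov u).card ≤ (cov v).card := by
    intro u v
    obtain ⟨e, he⟩ := hvt v u
    refine Finset.card_le_card_of_injOn (fun f => e.trans f) (fun f hf => ?_) ?_
    · simpa [hcov, he] using hf
    · intro f _ f' _ h
      ext x
      have := DFunLike.congr_fun h (e.symm x)
      simpa using this
  obtain ⟨v₀⟩ := (inferInstance : Nonempty V)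
  have heq : ∀ v, (cov v).card = (cov v₀).card := fun v => le_antisymm (hle _ _) (hle _ _)
  have hcount : Fintype.card V * (cov v₀).card = Fintype.card (G ≃g G) * S.card := by
    have h1 : ∑ v, (cov v).card = ∑ e : G ≃g G, S.card := by
      simp_rw [hcov, Finset.card_filter]
      rw [Finset.sum_comm]
      refine Finset.sum_congr rfl fun e _ => ?_
      refine (Equiv.sum_comp e.toEquiv (fun x => if x ∈ S then 1 else 0)).trans ?_
      simp
    simpa [heq] using h1
  have hpos : 0 < (cov v₀).card := by
    obtain ⟨s, hs⟩ := hne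
    obtain ⟨e, he⟩ := hvt v₀ s
    exact Finset.card_pos.2 ⟨e, by simp [hcov, he, hs]⟩
  refine csInf_le ⟨0, ?_⟩ ?_
  · rintro q ⟨a, b, -, rfl, -⟩
    positivity
  · refine ⟨Fintype.card (G ≃g G), (cov v₀).card, hpos, ?_,
      fun v => (cov v).map (Fintype.equivFin _).toEmbedding, fun v => by simp [heq v], ?_⟩
    · have : (0 : ℝ) < S.card := by exact_mod_cast Finset.card_pos.2 hne
      rw [div_eq_div_iff this.ne' (by positivity)]
      exact_mod_cast hcount
    · intro u v huv
      rw [Finset.disjoint_map, Finset.disjoint_left]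
      intro e he he'
      simp only [hcov, Finset.mem_filter, Finset.mem_univ, true_and] at he he'
      have := e.map_adj_iff.2 huv
      exact hS he he' this.ne this

/-- If `G` is vertex-transitive, then `χ_f(G) ≤ max{ω(G), (5/6)(Δ(G)+1)}`. -/
theorem transitive_fracChromaticNumber_le {V : Type*} [Fintype V] [DecidableEq V] [Nonempty V]
    (G : SimpleGraph V) [DecidableRel G.Adj] (hvt : VertexTransitive G) :
    fracChromaticNumber G ≤ max (G.cliqueNum : ℝ) (5 / 6 * ((G.maxDegree : ℝ) + 1)) := by
  obtain ⟨S, hS⟩ := G.exists_isNIndepSet_indepNum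
  have hreed := two_mul_card_le_indepNum_mul G
  have hV : 0 < Fintype.card V := Fintype.card_pos
  have hα : 0 < G.indepNum := by
    by_contra h
    simp [Nat.eq_zero_of_not_pos h] at hreed
  have hα' : (0 : ℝ) < G.indepNum := by exact_mod_cast hα
  refine (fracChromaticNumber_le_card_div_card G hvt S hS.isIndepSet
    (Finset.card_pos.1 (by rw [hS.card_eq]; exact hα))).trans ?_
  rw [hS.card_eq]
  by_cases hω : 2 * (G.maxDegree + 1) < 3 * G.cliqueNum
  · refine le_max_of_le_left ((div_le_iff₀' hα').2 ?_)
    exact_mod_cast card_le_indepNum_mul_cliqueNum G hvt hω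
  · refine le_max_of_le_right ((div_le_iff₀' hα').2 ?_)
    have h1 : (2 * Fintype.card V : ℝ) ≤ G.indepNum * (G.cliqueNum + G.maxDegree + 1) := by
      exact_mod_cast hreed
    have h2 : (3 * G.cliqueNum : ℝ) ≤ 2 * (G.maxDegree + 1) := by
      exact_mod_cast not_lt.1 hω
    nlinarith
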